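/- arXiv:0905.2249 — 5 statements merged into one kernel-verified Lean document; each statement's English description precedes it below -/
import Mathlib

section
/- Let P be a finite set of points in the plane in general position. If a→b and c→d are two distinct edges of the directed Yao graph Y4^{{0}}(P) (i.e. {a,b} ≠ {c,d} as edges), then the open line segments (a,b) and (c,d) are disjoint; in particular no two edges of Y4^{{0}}(P) properly cross, so Y4^{{0}}(P) is a plane (planar embedded) graph. -/
noncomputable section

/-- A point in the plane, with Euclidean distance. -/
abbrev Pt : Type := EuclideanSpace ℝ (Fin 2)

/-- `quadrant i a p` : `p` lies in the (open) quadrant `Q_i` at `a`. -/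
def quadrant : Fin 4 → Pt → Pt → Prop
  | 0, a, p => a 0 < p 0 ∧ a 1 < p 1
  | 1, a, p => p 0 < a 0 ∧ a 1 < p 1
  | 2, a, p => p 0 < a 0 ∧ p 1 < a 1
  | 3, a, p => a 0 < p 0 ∧ p 1 < a 1

/-- General position: all pairwise distances between distinct pairs are distinct,
and no two distinct points share an x- or y-coordinate. -/
def GenPos (P : Finset Pt) : Prop :=
  (∀ a ∈ P, ∀ b ∈ P, ∀ c ∈ P, ∀ d ∈ P,
      a ≠ b → c ≠ d → ({a, b} : Set Pt) ≠ ({c, d} : Set Pt) → dist a b ≠ dist c d) ∧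
  (∀ a ∈ P, ∀ b ∈ P, a ≠ b → a 0 ≠ b 0 ∧ a 1 ≠ b 1)

/-- `YaoEdge l P a b` : `a → b` is a directed edge of the Yao graph `Y4^l(P)`,
i.e. for some quadrant index `i ∈ l`, `b` is a point of `P` in `Q_i(a)` at minimum
Euclidean distance from `a`. -/
def YaoEdge (l : List (Fin 4)) (P : Finset Pt) (a b : Pt) : Prop :=
  a ∈ P ∧ b ∈ P ∧ ∃ i ∈ l, quadrant i a b ∧
    ∀ c ∈ P, quadrant i a c → dist a b ≤ dist a c

/-- The undirected edge relation underlying the directed Yao graph. -/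
def UYaoEdge (l : List (Fin 4)) (P : Finset Pt) (a b : Pt) : Prop :=
  YaoEdge l P a b ∨ YaoEdge l P b a

lemma yaoEdge_zero_iff {P : Finset Pt} {a b : Pt} :
    YaoEdge [0] P a b ↔ a ∈ P ∧ b ∈ P ∧ quadrant 0 a b ∧
      ∀ c ∈ P, quadrant 0 a c → dist a b ≤ dist a c := by
  simp [YaoEdge]

/-- A target of an outgoing edge is determined by the edge length. -/
lemma GenPos.eq_of_dist_eq {P : Finset Pt} (hGP : GenPos P) {a b d : Pt}
    (ha : a ∈ P) (hb : b ∈ P) (hd : d ∈ P) (hab : a ≠ b) (had : a ≠ d)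
    (h : dist a b = dist a d) : b = d := by
  by_contra hbd
  refine hGP.1 a ha b hb a ha d hd hab had (fun hs => ?_) h
  have hmem : b ∈ ({a, d} : Set Pt) := hs ▸ Set.mem_insert_of_mem a rfl
  rcases hmem with h | h
  exacts [hab h.symm, hbd h]

lemma quadrant.ne {a b : Pt} (h : quadrant 0 a b) : a ≠ b := by
  rintro rfl
  exact lt_irrefl _ h.1

lemma quadrant.dist_lt_dist {a b c : Pt} (hac : quadrant 0 a c) (hcb : quadrant 0 c b) :
    dist a c < dist a b := by
  obtain ⟨h₁, h₂⟩ := hac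
  obtain ⟨h₃, h₄⟩ := hcb
  simp only [EuclideanSpace.dist_eq, Fin.sum_univ_two, Real.dist_eq, sq_abs]
  apply Real.sqrt_lt_sqrt (by positivity)
  nlinarith

lemma quadrant.of_mem_openSegment {a b z : Pt} (h : quadrant 0 a b)
    (hz : z ∈ openSegment ℝ a b) : quadrant 0 a z ∧ quadrant 0 z b := by
  obtain ⟨s, t, hs, ht, hst, rfl⟩ := hz
  obtain ⟨h₀, h₁⟩ := h
  obtain rfl : s = 1 - t := by linarith
  simp only [quadrant, PiLp.add_apply, PiLp.smul_apply, smul_eq_mul]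
  refine ⟨⟨?_, ?_⟩, ?_, ?_⟩ <;> nlinarith

lemma quadrant.trans {a b c : Pt} (hab : quadrant 0 a b) (hbc : quadrant 0 b c) :
    quadrant 0 a c :=
  ⟨hab.1.trans hbc.1, hab.2.trans hbc.2⟩

/-- If the sources of two edges are comparable, the edges do not cross. -/
lemma YaoEdge.not_quadrant_of_mem {P : Finset Pt} {a b c d z : Pt}
    (hab : YaoEdge [0] P a b) (hcd : YaoEdge [0] P c d)
    (hz : z ∈ openSegment ℝ a b) (hz' : z ∈ openSegment ℝ c d) : ¬ quadrant 0 a c := by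
  intro hac
  obtain ⟨-, -, qab, hmin⟩ := yaoEdge_zero_iff.1 hab
  obtain ⟨hc, -, qcd, -⟩ := yaoEdge_zero_iff.1 hcd
  have hcb := (qcd.of_mem_openSegment hz').1.trans (qab.of_mem_openSegment hz).2
  exact (hmin c hc hac).not_gt (hac.dist_lt_dist hcb)

/-- If the source of one edge lies in the second quadrant of the source of another,
the edges do not cross. -/
lemma YaoEdge.not_quadrant_one_of_mem {P : Finset Pt} (hGP : GenPos P) {a b c d z : Pt}
    (hab : YaoEdge [0] P a b) (hcd : YaoEdge [0] P c d)
    (hz : z ∈ openSegment ℝ a b) (hz' : z ∈ openSegment ℝ c d) : ¬ quadrant 1 a c := by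
  rintro ⟨hx, hy⟩
  obtain ⟨ha, hb, qab, hmin⟩ := yaoEdge_zero_iff.1 hab
  obtain ⟨hc, hd, qcd, hmin'⟩ := yaoEdge_zero_iff.1 hcd
  obtain ⟨qaz, qzb⟩ := qab.of_mem_openSegment hz
  obtain ⟨qcz, qzd⟩ := qcd.of_mem_openSegment hz'
  have qad : quadrant 0 a d := qaz.trans qzd
  have hbd : b = d := by
    refine hGP.eq_of_dist_eq ha hb hd qab.ne qad.ne ?_
    have h₁ := hmin d hd qad
    have h₂ := hmin' b hb (qcz.trans qzb)
    have h₃ := dist_add_dist_of_mem_segment (openSegment_subset_segment ℝ a b hz)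
    have h₄ := dist_add_dist_of_mem_segment (openSegment_subset_segment ℝ c d hz')
    linarith [dist_triangle a z d, dist_triangle c z b]
  subst hbd
  obtain ⟨s, t, hs, -, hst, rfl⟩ := hz
  obtain ⟨u, v, hu, -, huv, he⟩ := hz'
  have e₀ := congrArg (fun p : Pt => p 0) he
  have e₁ := congrArg (fun p : Pt => p 1) he
  simp only [PiLp.add_apply, PiLp.smul_apply, smul_eq_mul] at e₀ e₁
  obtain rfl : t = 1 - s := by linarith
  obtain rfl : v = 1 - u := by linarith
  obtain ⟨h₀, h₁⟩ := qab
  obtain ⟨h₂, h₃⟩ := qcd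
  rcases le_total s u with h | h <;> nlinarith

/-- No two distinct edges of the directed Yao graph `Y4^{{0}}(P)` properly
cross: their open line segments are disjoint. -/
theorem yao0_edges_noncrossing (P : Finset Pt) (hGP : GenPos P) (a b c d : Pt)
    (hab : YaoEdge [0] P a b) (hcd : YaoEdge [0] P c d)
    (hne : ({a, b} : Set Pt) ≠ ({c, d} : Set Pt)) :
    openSegment ℝ a b ∩ openSegment ℝ c d = ∅ := by
  rw [Set.eq_empty_iff_forall_notMem]
  rintro z ⟨hz, hz'⟩
  obtain ⟨ha, hb, qab, hmin⟩ := yaoEdge_zero_iff.1 hab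
  obtain ⟨hc, hd, qcd, hmin'⟩ := yaoEdge_zero_iff.1 hcd
  by_cases hac : a = c
  · subst hac
    refine hne ?_
    rw [hGP.eq_of_dist_eq ha hb hd qab.ne qcd.ne
      (le_antisymm (hmin d hd qcd) (hmin' b hb qab))]
  obtain ⟨h₀, h₁⟩ := hGP.2 a ha c hc hac
  rcases lt_or_gt_of_ne h₀ with h₀ | h₀ <;> rcases lt_or_gt_of_ne h₁ with h₁ | h₁
  · exact hab.not_quadrant_of_mem hcd hz hz' ⟨h₀, h₁⟩
  · exact hcd.not_quadrant_one_of_mem hGP hab hz' hz ⟨h₀, h₁⟩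
  · exact hab.not_quadrant_one_of_mem hGP hcd hz hz' ⟨h₀, h₁⟩
  · exact hcd.not_quadrant_of_mem hab hz' hz ⟨h₀, h₁⟩
end
end

section
/- Let P be a nonempty finite set of points in the plane in general position. Then the undirected graph underlying the directed Yao graph Y4^{{0,1}}(P) is connected. -/
noncomputable section

/-- A point of `P` in an allowed quadrant `Q_i(a)` yields an edge from `a` into `Q_i(a)`. -/
theorem exists_yaoEdge_of_quadrant {l : List (Fin 4)} {P : Finset Pt} {a c : Pt} {i : Fin 4}
    (hi : i ∈ l) (ha : a ∈ P) (hc : c ∈ P) (hac : quadrant i a c) :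
    ∃ b, YaoEdge l P a b ∧ quadrant i a b := by
  classical
  obtain ⟨b, hb, hmin⟩ := (P.filter (quadrant i a)).exists_min_image (dist a)
    ⟨c, Finset.mem_filter.2 ⟨hc, hac⟩⟩
  rw [Finset.mem_filter] at hb
  exact ⟨b, ⟨ha, hb.1, i, hi, hb.2, fun d hd had => hmin d (Finset.mem_filter.2 ⟨hd, had⟩)⟩, hb.2⟩

/-- In `Y4^{{0,1}}(P)`, every point that is not topmost has an edge to a strictly higher point. -/
theorem exists_yaoEdge_above {P : Finset Pt} (hGP : GenPos P) {a c : Pt}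
    (ha : a ∈ P) (hc : c ∈ P) (hac : a 1 < c 1) :
    ∃ b, YaoEdge [0, 1] P a b ∧ a 1 < b 1 := by
  have hne : a ≠ c := fun h => hac.ne (congrArg (fun p : Pt => p 1) h)
  rcases lt_or_gt_of_ne (hGP.2 a ha c hc hne).1 with hx | hx
  · obtain ⟨b, hab, hq⟩ := exists_yaoEdge_of_quadrant (l := [0, 1]) (i := 0) (by simp) ha hc
      ⟨hx, hac⟩
    exact ⟨b, hab, hq.2⟩
  · obtain ⟨b, hab, hq⟩ := exists_yaoEdge_of_quadrant (l := [0, 1]) (i := 1) (by simp) ha hc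
      ⟨hx, hac⟩
    exact ⟨b, hab, hq.2⟩

/-- Every point is joined in `Y4^{{0,1}}(P)` to the topmost point. -/
theorem reflTransGen_top {P : Finset Pt} (hGP : GenPos P) {t : Pt} (ht : t ∈ P)
    (htop : ∀ p ∈ P, p 1 ≤ t 1) {a : Pt} (ha : a ∈ P) :
    Relation.ReflTransGen (UYaoEdge [0, 1] P) a t := by
  classical
  by_contra hna
  obtain ⟨m, hm, hmax⟩ :=
    (P.filter fun p => ¬ Relation.ReflTransGen (UYaoEdge [0, 1] P) p t).exists_max_image
      (fun p => p 1) ⟨a, Finset.mem_filter.2 ⟨ha, hna⟩⟩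
  obtain ⟨hmP, hmt⟩ := Finset.mem_filter.1 hm
  have hne : m ≠ t := by
    rintro rfl
    exact hmt .refl
  obtain ⟨b, hmb, hlt⟩ := exists_yaoEdge_above hGP hmP ht
    (lt_of_le_of_ne (htop m hmP) (hGP.2 m hmP t ht hne).2)
  by_cases hbt : Relation.ReflTransGen (UYaoEdge [0, 1] P) b t
  · exact hmt (.head (Or.inl hmb) hbt)
  · exact absurd (hmax b (Finset.mem_filter.2 ⟨hmb.2.1, hbt⟩)) (not_le.2 hlt)

/-- For a nonempty finite point set in general position, the undirected
graph underlying the directed Yao graph `Y4^{{0,1}}(P)` is connected. -/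
theorem yao01_connected (P : Finset Pt) (hne : P.Nonempty) (hGP : GenPos P) :
    ∀ a ∈ P, ∀ b ∈ P, Relation.ReflTransGen (UYaoEdge [0, 1] P) a b := by
  obtain ⟨t, ht, htop⟩ := P.exists_max_image (fun p => p 1) hne
  intro a ha b hb
  exact (reflTransGen_top hGP ht htop ha).trans <| Relation.ReflTransGen.mono
    (fun _ _ => Or.symm) _ _ (Relation.reflTransGen_swap.2 (reflTransGen_top hGP ht htop hb))
end
end

section
/- Let P be a finite set of points in the plane in general position, and let p₀ → p₁ → ⋯ → p_k be a directed path in the directed Yao graph Y4^{{0}}(P) from a = p₀ to b = p_k. Then the total Euclidean length of the path satisfies Σ_{j=0}^{k-1} dist(p_j, p_{j+1}) ≤ √2 · dist(a, b). In other words, the directed graph Y4^{{0}}(P) is a directed √2-spanner along its directed paths. -/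
noncomputable section

/-- The Euclidean distance of two coordinatewise ordered points is at most their `ℓ¹` distance. -/
theorem dist_le_add_sub {a b : Pt} (h₀ : a 0 ≤ b 0) (h₁ : a 1 ≤ b 1) :
    dist a b ≤ (b 0 - a 0) + (b 1 - a 1) := by
  rw [EuclideanSpace.dist_eq, Fin.sum_univ_two, Real.dist_eq, Real.dist_eq, sq_abs, sq_abs]
  apply Real.sqrt_le_iff.mpr
  constructor <;> nlinarith [mul_nonneg (sub_nonneg.mpr h₀) (sub_nonneg.mpr h₁)]

/-- The signed `ℓ¹` distance of two points is at most `√2` times their Euclidean distance. -/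
theorem add_sub_le_sqrt_two_mul_dist (a b : Pt) :
    (b 0 - a 0) + (b 1 - a 1) ≤ Real.sqrt 2 * dist a b := by
  rw [EuclideanSpace.dist_eq, Fin.sum_univ_two, Real.dist_eq, Real.dist_eq, sq_abs, sq_abs,
    ← Real.sqrt_mul zero_le_two]
  apply Real.le_sqrt_of_sq_le
  nlinarith [sq_nonneg ((b 0 - a 0) - (b 1 - a 1))]

/-- An edge of `Y4^{{0}}(P)` points into the upper right quadrant. -/
theorem YaoEdge.quadrant_zero {P : Finset Pt} {a b : Pt} (h : YaoEdge [0] P a b) :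
    a 0 < b 0 ∧ a 1 < b 1 := by
  obtain ⟨-, -, i, hi, hq, -⟩ := h
  rw [List.mem_singleton.mp hi] at hq
  exact hq

/-- Any directed path in `Y4^{{0}}(P)` has total Euclidean length at most
`√2` times the Euclidean distance between its endpoints. -/
theorem yao0_directed_spanner (P : Finset Pt) (hGP : GenPos P)
    (k : ℕ) (p : ℕ → Pt) (hpath : ∀ j < k, YaoEdge [0] P (p j) (p (j + 1))) :
    ∑ j ∈ Finset.range k, dist (p j) (p (j + 1)) ≤ Real.sqrt 2 * dist (p 0) (p k) := by
  calc ∑ j ∈ Finset.range k, dist (p j) (p (j + 1))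
      ≤ ∑ j ∈ Finset.range k, ((p (j + 1) 0 - p j 0) + (p (j + 1) 1 - p j 1)) := by
        refine Finset.sum_le_sum fun j hj => ?_
        have h := (hpath j (Finset.mem_range.mp hj)).quadrant_zero
        exact dist_le_add_sub h.1.le h.2.le
    _ = (p k 0 - p 0 0) + (p k 1 - p 0 1) := by
        rw [Finset.sum_add_distrib, Finset.sum_range_sub (fun j => p j 0),
          Finset.sum_range_sub (fun j => p j 1)]
    _ ≤ Real.sqrt 2 * dist (p 0) (p k) := add_sub_le_sqrt_two_mul_dist _ _
end
end

section
/- There exists a finite set P of points in the plane in general position such that the directed Yao graph Y4^{{0,1}}(P) is not planar as drawn: there are two directed edges a→b and c→d of Y4^{{0,1}}(P) with {a,b} ∩ {c,d} = ∅ whose closed line segments [a,b] and [c,d] intersect in a point interior to both segments (the edges properly cross). -/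
noncomputable section

/-- The point of the plane with the given integer coordinates. -/
def latticePt (p : ℤ × ℤ) : Pt := !₂[(p.1 : ℝ), (p.2 : ℝ)]

/-- The squared Euclidean distance between two lattice points. -/
def latticeSqDist (p q : ℤ × ℤ) : ℤ := (p.1 - q.1) ^ 2 + (p.2 - q.2) ^ 2

@[simp]
theorem latticePt_zero (p : ℤ × ℤ) : latticePt p 0 = p.1 := by
  simp [latticePt]

@[simp]
theorem latticePt_one (p : ℤ × ℤ) : latticePt p 1 = p.2 := by
  simp [latticePt]

theorem latticePt_injective : Function.Injective latticePt := by
  intro p q h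
  have h0 := congrArg (fun r : Pt => r 0) h
  have h1 := congrArg (fun r : Pt => r 1) h
  simp only [latticePt_zero, latticePt_one, Int.cast_inj] at h0 h1
  exact Prod.ext h0 h1

theorem dist_latticePt (p q : ℤ × ℤ) :
    dist (latticePt p) (latticePt q) = √(latticeSqDist p q : ℝ) := by
  simp [EuclideanSpace.dist_eq, Fin.sum_univ_two, Real.dist_eq, sq_abs, latticeSqDist]

theorem latticeSqDist_nonneg (p q : ℤ × ℤ) : 0 ≤ latticeSqDist p q := by
  unfold latticeSqDist
  positivity

theorem dist_latticePt_inj {p q r s : ℤ × ℤ} :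
    dist (latticePt p) (latticePt q) = dist (latticePt r) (latticePt s) ↔
      latticeSqDist p q = latticeSqDist r s := by
  rw [dist_latticePt, dist_latticePt, Real.sqrt_inj
    (by exact_mod_cast latticeSqDist_nonneg p q) (by exact_mod_cast latticeSqDist_nonneg r s)]
  exact Int.cast_inj

theorem dist_latticePt_le {p q r s : ℤ × ℤ} (h : latticeSqDist p q ≤ latticeSqDist r s) :
    dist (latticePt p) (latticePt q) ≤ dist (latticePt r) (latticePt s) := by
  rw [dist_latticePt, dist_latticePt]
  exact Real.sqrt_le_sqrt (by exact_mod_cast h)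

open Classical in
/-- A finite set of lattice points whose coordinates are pairwise distinct and whose pairs of
points have pairwise distinct squared distances is in general position. -/
theorem genPos_image_latticePt {S : Finset (ℤ × ℤ)}
    (hdist : ∀ p ∈ S, ∀ q ∈ S, ∀ r ∈ S, ∀ s ∈ S, p ≠ q → r ≠ s →
      latticeSqDist p q = latticeSqDist r s → (p = r ∧ q = s) ∨ (p = s ∧ q = r))
    (hcoord : ∀ p ∈ S, ∀ q ∈ S, p ≠ q → p.1 ≠ q.1 ∧ p.2 ≠ q.2) :
    GenPos (S.image latticePt) := by
  simp only [GenPos, Finset.forall_mem_image]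
  refine ⟨fun p hp q hq r hr s hs hpq hrs hne heq => hne ?_, fun p hp q hq hpq => ?_⟩
  · rcases hdist p hp q hq r hr s hs (ne_of_apply_ne _ hpq) (ne_of_apply_ne _ hrs)
      (dist_latticePt_inj.1 heq) with ⟨rfl, rfl⟩ | ⟨rfl, rfl⟩
    · rfl
    · exact Set.pair_comm _ _
  · simpa using hcoord p hp q hq (ne_of_apply_ne _ hpq)

/-- Four lattice points for which the Yao edges `(11, 3) → (0, 4)` and `(1, 1) → (2, 11)` cross. -/
def crossingPoints : Finset (ℤ × ℤ) := {(11, 3), (0, 4), (1, 1), (2, 11)}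

open Classical in
theorem yaoEdge_eleven_three :
    YaoEdge [0, 1] (crossingPoints.image latticePt) (latticePt (11, 3)) (latticePt (0, 4)) := by
  refine ⟨Finset.mem_image_of_mem _ (by decide), Finset.mem_image_of_mem _ (by decide),
    1, by simp, by simp [quadrant]; norm_num, ?_⟩
  simp only [Finset.forall_mem_image, quadrant, latticePt_zero, latticePt_one, Int.cast_lt]
  intro p hp hquad
  have key : ∀ p ∈ crossingPoints, p.1 < 11 ∧ 3 < p.2 →
      latticeSqDist (11, 3) (0, 4) ≤ latticeSqDist (11, 3) p := by decide
  exact dist_latticePt_le (key p hp hquad)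

open Classical in
theorem yaoEdge_one_one :
    YaoEdge [0, 1] (crossingPoints.image latticePt) (latticePt (1, 1)) (latticePt (2, 11)) := by
  refine ⟨Finset.mem_image_of_mem _ (by decide), Finset.mem_image_of_mem _ (by decide),
    0, by simp, by simp [quadrant], ?_⟩
  simp only [Finset.forall_mem_image, quadrant, latticePt_zero, latticePt_one, Int.cast_lt]
  intro p hp hquad
  have key : ∀ p ∈ crossingPoints, 1 < p.1 ∧ 1 < p.2 →
      latticeSqDist (1, 1) (2, 11) ≤ latticeSqDist (1, 1) p := by decide
  exact dist_latticePt_le (key p hp hquad)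

/-- There is a finite point set `P` in general position such that two
vertex-disjoint edges of `Y4^{{0,1}}(P)` properly cross: some point lies in the interior
(open segment) of both edges. -/
theorem yao01_not_planar :
    ∃ (P : Finset Pt), GenPos P ∧ ∃ a b c d : Pt,
      YaoEdge [0, 1] P a b ∧ YaoEdge [0, 1] P c d ∧
      ({a, b} : Set Pt) ∩ ({c, d} : Set Pt) = ∅ ∧
      ∃ x : Pt, x ∈ openSegment ℝ a b ∧ x ∈ openSegment ℝ c d := by
  classical
  refine ⟨crossingPoints.image latticePt, genPos_image_latticePt (by decide) (by decide),
    latticePt (11, 3), latticePt (0, 4), latticePt (1, 1), latticePt (2, 11),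
    yaoEdge_eleven_three, yaoEdge_one_one, ?_, !₂[143 / 111, 431 / 111],
    ⟨13 / 111, 98 / 111, by norm_num, by norm_num, by norm_num, ?_⟩,
    ⟨79 / 111, 32 / 111, by norm_num, by norm_num, by norm_num, ?_⟩⟩
  · rw [← Set.disjoint_iff_inter_eq_empty]
    simp [latticePt_injective.eq_iff]
  · ext i
    fin_cases i <;> norm_num [latticePt]
  · ext i
    fin_cases i <;> norm_num [latticePt]
end
end

section
/- For every real constant t ≥ 1 there exists a finite set P of points in the plane in general position and points a, b ∈ P such that every undirected path between a and b in the undirected graph underlying Y4^{{0,1}}(P) has total Euclidean length greater than t · dist(a, b). Hence the undirected graph Y4^{{0,1}} is not a t-spanner for any constant t. (For example, points uniformly spaced on the two legs of a 'Λ' shape, with a and b the two lowest endpoints, have this property.) -/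
noncomputable section

/-- The zero set of a nonconstant quartic without cubic term is finite. -/
theorem finite_setOf_quartic_eq_zero (A C D E : ℝ) (h : A ≠ 0 ∨ C ≠ 0 ∨ D ≠ 0) :
    {s : ℝ | A * s ^ 4 + C * s ^ 2 + D * s + E = 0}.Finite := by
  classical
  let f : Polynomial ℝ := .C A * .X ^ 4 + .C C * .X ^ 2 + .C D * .X + .C E
  have hf : f ≠ 0 := by
    intro h0
    have hc : ∀ n, f.coeff n = 0 := by simp [h0]
    have h4 := hc 4
    have h2 := hc 2
    have h1 := hc 1
    simp [f, Polynomial.coeff_C, Polynomial.coeff_X_pow] at h4 h2 h1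
    tauto
  refine f.roots.toFinset.finite_toSet.subset fun s hs => ?_
  simpa [f, hf] using hs

theorem dist_sq_eq_coords (a b : Pt) : dist a b ^ 2 = (a 0 - b 0) ^ 2 + (a 1 - b 1) ^ 2 := by
  rw [EuclideanSpace.dist_eq, Real.sq_sqrt (by positivity)]
  simp [Real.dist_eq, sq_abs]

theorem abs_coord_sub_le_dist (a b : Pt) (i : Fin 2) : |a i - b i| ≤ dist a b := by
  refine abs_le_of_sq_le_sq ?_ dist_nonneg
  rw [dist_sq_eq_coords]
  fin_cases i
  · exact le_add_of_nonneg_right (sq_nonneg _)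
  · exact le_add_of_nonneg_left (sq_nonneg _)

/-- A point of a parabola through `q`. -/
def parabola (q : Pt) (s : ℝ) : Pt := !₂[q 0 + s, q 1 + s ^ 2]

theorem continuous_parabola (q : Pt) : Continuous (parabola q) := by
  unfold parabola
  fun_prop

theorem finite_parabola_dist_eq (q c : Pt) (r : ℝ) : {s | dist (parabola q s) c = r}.Finite := by
  refine (finite_setOf_quartic_eq_zero 1 (1 + 2 * (q 1 - c 1)) (2 * (q 0 - c 0))
    ((q 0 - c 0) ^ 2 + (q 1 - c 1) ^ 2 - r ^ 2) (by simp)).subset fun s hs => ?_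
  have h := dist_sq_eq_coords (parabola q s) c
  rw [show dist (parabola q s) c = r from hs] at h
  simp only [parabola, PiLp.toLp_apply, Matrix.cons_val_zero, Matrix.cons_val_one] at h
  simp only [Set.mem_ofPred_eq]
  linarith

theorem finite_parabola_dist_eq_dist (q : Pt) {c d : Pt} (hcd : c ≠ d) :
    {s | dist (parabola q s) c = dist (parabola q s) d}.Finite := by
  refine (finite_setOf_quartic_eq_zero 0 (2 * (d 1 - c 1)) (2 * (d 0 - c 0))
    ((q 0 - c 0) ^ 2 + (q 1 - c 1) ^ 2 - (q 0 - d 0) ^ 2 - (q 1 - d 1) ^ 2) ?_).subset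
    fun s hs => ?_
  · by_contra! h
    refine hcd ?_
    ext i
    fin_cases i
    · simpa using (by linarith : c 0 = d 0)
    · simpa using (by linarith : c 1 = d 1)
  · have hc := dist_sq_eq_coords (parabola q s) c
    rw [show dist (parabola q s) c = dist (parabola q s) d from hs, dist_sq_eq_coords] at hc
    simp only [parabola, PiLp.toLp_apply, Matrix.cons_val_zero, Matrix.cons_val_one] at hc
    simp only [Set.mem_ofPred_eq]
    linarith

theorem finite_parabola_zero_eq (q : Pt) (r : ℝ) : {s | parabola q s 0 = r}.Finite := by
  refine (finite_setOf_quartic_eq_zero 0 0 1 (q 0 - r) (by simp)).subset fun s hs => ?_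
  have h : q 0 + s = r := hs
  simp only [Set.mem_ofPred_eq]
  linarith

theorem finite_parabola_one_eq (q : Pt) (r : ℝ) : {s | parabola q s 1 = r}.Finite := by
  refine (finite_setOf_quartic_eq_zero 0 1 0 (q 1 - r) (by simp)).subset fun s hs => ?_
  have h : q 1 + s ^ 2 = r := hs
  simp only [Set.mem_ofPred_eq]
  linarith

/-- Sufficient condition for general position to be preserved when a point is added. -/
theorem GenPos.insert_of_forall [DecidableEq Pt] {P : Finset Pt} (hP : GenPos P) {q : Pt}
    (hdist : ∀ b ∈ P, ∀ c ∈ P, ∀ d ∈ P, dist q b ≠ dist c d)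
    (hbis : ∀ b ∈ P, ∀ d ∈ P, b ≠ d → dist q b ≠ dist q d)
    (hcoord : ∀ b ∈ P, q 0 ≠ b 0 ∧ q 1 ≠ b 1) : GenPos (insert q P) := by
  constructor
  · intro a ha b hb c hc d hd hab hcd hne
    rw [Finset.mem_insert] at ha hb hc hd
    rcases ha with rfl | ha <;> rcases hb with rfl | hb <;>
      rcases hc with rfl | hc <;> rcases hd with rfl | hd <;>
      try first | exact absurd rfl hab | exact absurd rfl hcd
    · exact hbis _ hb _ hd fun h => hne (by rw [h])
    · rw [dist_comm c]
      exact hbis _ hb _ hc fun h => hne (by rw [h, Set.pair_comm])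
    · exact hdist _ hb _ hc _ hd
    · rw [dist_comm a]
      exact hbis _ ha _ hd fun h => hne (by rw [h, Set.pair_comm])
    · rw [dist_comm a, dist_comm c]
      exact hbis _ ha _ hc fun h => hne (by rw [h])
    · rw [dist_comm a]
      exact hdist _ ha _ hc _ hd
    · exact (hdist _ hd _ ha _ hb).symm
    · rw [dist_comm c]
      exact (hdist _ hc _ ha _ hb).symm
    · exact hP.1 _ ha _ hb _ hc _ hd hab hcd hne
  · intro a ha b hb hab
    rw [Finset.mem_insert] at ha hb
    rcases ha with rfl | ha <;> rcases hb with rfl | hb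
    · exact absurd rfl hab
    · exact hcoord _ hb
    · exact ⟨(hcoord _ ha).1.symm, (hcoord _ ha).2.symm⟩
    · exact hP.2 _ ha _ hb hab

theorem GenPos.exists_mem_insert [DecidableEq Pt] {P : Finset Pt} (hP : GenPos P) {U : Set Pt}
    (hU : IsOpen U) (hne : U.Nonempty) : ∃ q ∈ U, GenPos (insert q P) := by
  obtain ⟨q, hq⟩ := hne
  have hnhds : parabola q ⁻¹' U ∈ nhds (0 : ℝ) := by
    refine (hU.preimage (continuous_parabola q)).mem_nhds ?_
    have h0 : parabola q 0 = q := by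
      ext i
      fin_cases i <;> simp [parabola]
    simpa [h0] using hq
  let bad : Set ℝ :=
    (⋃ b ∈ P, ⋃ c ∈ P, ⋃ d ∈ P, {s | dist (parabola q s) b = dist c d}) ∪
    (⋃ b ∈ P, ⋃ d ∈ P, {s | b ≠ d ∧ dist (parabola q s) b = dist (parabola q s) d}) ∪
    (⋃ b ∈ P, {s | parabola q s 0 = b 0}) ∪ (⋃ b ∈ P, {s | parabola q s 1 = b 1})
  have hbad : bad.Finite := by
    refine (((?_ : Set.Finite _).union ?_).union ?_).union ?_
    · exact P.finite_toSet.biUnion fun b _ => P.finite_toSet.biUnion fun c _ =>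
        P.finite_toSet.biUnion fun d _ => finite_parabola_dist_eq q b _
    · refine P.finite_toSet.biUnion fun b _ => P.finite_toSet.biUnion fun d _ => ?_
      by_cases hbd : b = d
      · simp [hbd]
      · simpa [hbd] using finite_parabola_dist_eq_dist q hbd
    · exact P.finite_toSet.biUnion fun b _ => finite_parabola_zero_eq q _
    · exact P.finite_toSet.biUnion fun b _ => finite_parabola_one_eq q _
  obtain ⟨s, hsU, hs⟩ := (infinite_of_mem_nhds (0 : ℝ) hnhds).exists_notMem_finite hbad
  simp only [bad, Set.mem_union, Set.mem_iUnion, Set.mem_ofPred_eq, not_or, not_exists,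
    not_and] at hs
  obtain ⟨⟨⟨hdist, hbis⟩, hzero⟩, hone⟩ := hs
  exact ⟨parabola q s, hsU, hP.insert_of_forall (fun b hb c hc d hd => hdist b hb c hc d hd)
    (fun b hb d hd => hbis b hb d hd) fun b hb => ⟨hzero b hb, hone b hb⟩⟩

/-- Points in general position can be chosen in any finite family of nonempty open sets. -/
theorem exists_genPos_image [DecidableEq Pt] {ι : Type*} [DecidableEq ι] (S : Finset ι)
    (U : ι → Set Pt) (hU : ∀ i, IsOpen (U i)) (hne : ∀ i, (U i).Nonempty) :
    ∃ p : ι → Pt, (∀ i, p i ∈ U i) ∧ GenPos (S.image p) := by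
  induction S using Finset.induction_on with
  | empty =>
    choose p hp using hne
    exact ⟨p, hp, by simp [GenPos]⟩
  | insert i S hi ih =>
    obtain ⟨p, hp, hgen⟩ := ih
    obtain ⟨q, hq, hgen'⟩ := hgen.exists_mem_insert (hU i) (hne i)
    refine ⟨Function.update p i q, fun j => ?_, ?_⟩
    · by_cases hj : j = i
      · subst hj
        simpa using hq
      · simpa [hj] using hp j
    · have himage : S.image (Function.update p i q) = S.image p :=
        Finset.image_congr fun j hj => by
          rw [Function.update_of_ne]
          rintro rfl
          exact hi hj
      rwa [Finset.image_insert, himage, Function.update_self]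

/-- The sign attached to a leg of the `Λ` shape: `true` is the right leg. -/
def legSign (b : Bool) : ℝ := if b then 1 else -1

/-- The open box, at height about `j / 2` on a leg of the `Λ` shape, in which a point is placed;
consecutive boxes are `δ` closer to the vertical axis. -/
def legBox (δ : ℝ) (i : ℕ × Bool) : Set Pt :=
  {q | 1 - (i.1 + 1) * δ < legSign i.2 * q 0 ∧ legSign i.2 * q 0 < 1 - i.1 * δ ∧
    (i.1 : ℝ) / 2 < q 1 ∧ q 1 < i.1 / 2 + 1 / 8}

theorem isOpen_legBox (δ : ℝ) (i : ℕ × Bool) : IsOpen (legBox δ i) := by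
  refine IsOpen.and ?_ (IsOpen.and ?_ (IsOpen.and ?_ ?_)) <;>
    exact isOpen_lt (by fun_prop) (by fun_prop)

theorem legBox_nonempty {δ : ℝ} (hδ : 0 < δ) (i : ℕ × Bool) : (legBox δ i).Nonempty := by
  obtain ⟨j, b⟩ := i
  refine ⟨!₂[legSign b * (1 - (j + 1 / 2) * δ), (j : ℝ) / 2 + 1 / 16], ?_⟩
  cases b <;> simp only [legBox, legSign, Set.mem_ofPred_eq,
    Matrix.cons_val_zero, Matrix.cons_val_one, Bool.false_eq_true, if_true, if_false] <;>
    refine ⟨?_, ?_, ?_, ?_⟩ <;> linarith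

section Lambda

variable {N : ℕ} {δ : ℝ} {p : ℕ × Bool → Pt}

theorem half_lt_of_mem_legBox (hδ : 0 < δ) (hN : (N + 1) * δ = 1 / 2) {j : ℕ} {b : Bool}
    (hj : j ≤ N) {q : Pt} (hq : q ∈ legBox δ (j, b)) :
    1 / 2 < legSign b * q 0 ∧ legSign b * q 0 < 1 := by
  have hj' : (j : ℝ) ≤ N := by exact_mod_cast hj
  obtain ⟨h1, h2, -, -⟩ := hq
  dsimp only at h1 h2
  have : 0 ≤ j * δ := by positivity
  exact ⟨by nlinarith, by linarith⟩

/-- A Yao edge in the upper quadrants joining the two legs starts at the top of a leg. -/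
theorem le_height_of_yaoEdge_of_crossing [DecidableEq Pt] (hδ : 0 < δ)
    (hN : (N + 1) * δ = 1 / 2) (hp : ∀ i, p i ∈ legBox δ i) {u v : Pt}
    (huv : YaoEdge [0, 1] ((Finset.range (N + 1) ×ˢ Finset.univ).image p) u v)
    (hcross : u 0 * v 0 < 0) : (N : ℝ) / 2 ≤ u 1 := by
  obtain ⟨hu, hv, i, hi, hquad, hmin⟩ := huv
  simp only [Finset.mem_image, Finset.mem_product, Finset.mem_range, Finset.mem_univ, and_true,
    Prod.exists] at hu hv
  obtain ⟨j, b, hj, rfl⟩ := hu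
  obtain ⟨j', b', hj', rfl⟩ := hv
  rcases (Nat.lt_succ_iff.mp hj).eq_or_lt with rfl | hlt
  · exact (hp (j, b)).2.2.1.le
  exfalso
  have hbu := half_lt_of_mem_legBox hδ hN hlt.le (hp (j, b))
  have hbw := half_lt_of_mem_legBox hδ hN (Nat.succ_le_of_lt hlt) (hp (j + 1, b))
  have hbv := half_lt_of_mem_legBox hδ hN (Nat.lt_succ_iff.mp hj') (hp (j', b'))
  have hw : p (j + 1, b) ∈ (Finset.range (N + 1) ×ˢ Finset.univ).image p :=
    Finset.mem_image_of_mem _ (by simpa using hlt)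
  obtain ⟨hu1, -, hu3, hu4⟩ := hp (j, b)
  obtain ⟨-, hw2, hw3, hw4⟩ := hp (j + 1, b)
  push_cast at hu1 hu3 hu4 hw2 hw3 hw4
  have hshort : dist (p (j, b)) (p (j + 1, b)) < 1 := by
    refine (sq_lt_one_iff₀ dist_nonneg).mp ?_
    rw [dist_sq_eq_coords]
    have hx : (p (j, b) 0 - p (j + 1, b) 0) ^ 2 ≤ (1 / 2) ^ 2 := by
      refine sq_le_sq' ?_ ?_ <;> cases b <;> simp [legSign] at hbu hbw <;> linarith
    have hy : (p (j, b) 1 - p (j + 1, b) 1) ^ 2 ≤ (5 / 8) ^ 2 := by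
      refine sq_le_sq' ?_ ?_ <;> linarith
    linarith
  have hlong : 1 < dist (p (j, b)) (p (j', b')) := by
    refine lt_of_lt_of_le ?_ (abs_coord_sub_le_dist _ _ 0)
    rw [lt_abs]
    cases b <;> cases b' <;> simp [legSign] at hbu hbv
    · nlinarith
    · right; linarith
    · left; linarith
    · nlinarith
  refine absurd (hmin _ hw ?_) (by linarith)
  cases b <;> simp [legSign] at hbu hu1 hw2 <;>
    rcases (by simpa using hi : i = 0 ∨ i = 1) with rfl | rfl
  · exact ⟨by linarith, by linarith⟩
  · have := hquad.1
    nlinarith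
  · have := hquad.1
    nlinarith
  · exact ⟨by linarith, by linarith⟩

end Lambda

/-- A real sequence with a negative value at `0` and a nonnegative one at `k` changes sign. -/
theorem exists_sign_change {f : ℕ → ℝ} {k : ℕ} (h0 : f 0 < 0) (hk : 0 ≤ f k) :
    ∃ j < k, f j < 0 ∧ 0 ≤ f (j + 1) := by
  induction k with
  | zero => linarith
  | succ k ih =>
    by_cases h : 0 ≤ f k
    · obtain ⟨j, hj, hj'⟩ := ih h
      exact ⟨j, hj.trans k.lt_succ_self, hj'⟩
    · exact ⟨k, k.lt_succ_self, not_le.mp h, hk⟩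

theorem dist_le_sum_dist_of_le (p : ℕ → Pt) {m k : ℕ} (hmk : m ≤ k) :
    dist (p 0) (p m) ≤ ∑ j ∈ Finset.range k, dist (p j) (p (j + 1)) :=
  (dist_le_range_sum_dist p m).trans <| Finset.sum_le_sum_of_subset_of_nonneg
    (Finset.range_mono hmk) fun _ _ _ => dist_nonneg

/-- For every `t ≥ 1` there is a finite point set `P` in general position
and `a, b ∈ P` such that every undirected path between `a` and `b` in the undirected
graph underlying `Y4^{{0,1}}(P)` has total length more than `t · dist a b`.
Hence undirected `Y4^{{0,1}}` is not a `t`-spanner for any constant `t`. -/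
theorem yao01_not_undirected_spanner :
    ∀ t : ℝ, 1 ≤ t → ∃ (P : Finset Pt), GenPos P ∧ ∃ a ∈ P, ∃ b ∈ P,
      ∀ (k : ℕ) (p : ℕ → Pt), p 0 = a → p k = b →
        (∀ j < k, UYaoEdge [0, 1] P (p j) (p (j + 1))) →
        t * dist a b < ∑ j ∈ Finset.range k, dist (p j) (p (j + 1)) := by
  classical
  intro t ht
  obtain ⟨N, hNt⟩ := exists_nat_gt (6 * t + 1)
  set δ : ℝ := 1 / (2 * (N + 1)) with hδdef
  have hδ : 0 < δ := by positivity
  have hN : (N + 1) * δ = 1 / 2 := by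
    rw [hδdef]
    field_simp
  obtain ⟨q, hq, hgen⟩ := exists_genPos_image (Finset.range (N + 1) ×ˢ Finset.univ)
    (legBox δ) (isOpen_legBox δ) (legBox_nonempty hδ)
  set P := (Finset.range (N + 1) ×ˢ Finset.univ).image q with hP
  have hmem : ∀ b, q (0, b) ∈ P := fun b => Finset.mem_image_of_mem _ (by simp)
  have hx_ne : ∀ u ∈ P, u 0 ≠ 0 := by
    intro u hu hu0
    simp only [hP, Finset.mem_image, Finset.mem_product, Finset.mem_range, Finset.mem_univ,
      and_true, Prod.exists] at hu
    obtain ⟨j, b, hj, rfl⟩ := hu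
    have := (half_lt_of_mem_legBox hδ hN (Nat.lt_succ_iff.mp hj) (hq (j, b))).1
    rw [hu0] at this
    norm_num at this
  have ha := half_lt_of_mem_legBox hδ hN N.zero_le (hq (0, false))
  have hb := half_lt_of_mem_legBox hδ hN N.zero_le (hq (0, true))
  obtain ⟨-, -, ha3, ha4⟩ := hq (0, false)
  obtain ⟨-, -, hb3, hb4⟩ := hq (0, true)
  simp [legSign] at ha hb ha3 ha4 hb3 hb4
  refine ⟨P, hgen, q (0, false), hmem _, q (0, true), hmem _, fun k p hp0 hpk hedge => ?_⟩
  have hbase : dist (q (0, false)) (q (0, true)) ≤ 3 := by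
    refine le_of_sq_le_sq ?_ (by norm_num)
    rw [dist_sq_eq_coords]
    nlinarith
  obtain ⟨j, hjk, hj, hj'⟩ := exists_sign_change (f := fun j => p j 0) (k := k)
    (by simp only [hp0]; linarith) (by simp only [hpk]; linarith)
  have hright : p (j + 1) ∈ P := by
    rcases hedge j hjk with h | h
    exacts [h.2.1, h.1]
  have hcross : p j 0 * p (j + 1) 0 < 0 :=
    mul_neg_of_neg_of_pos hj (lt_of_le_of_ne hj' (hx_ne _ hright).symm)
  obtain ⟨m, hmk, hm⟩ : ∃ m ≤ k, (N : ℝ) / 2 ≤ p m 1 := by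
    rcases hedge j hjk with h | h
    · exact ⟨j, hjk.le, le_height_of_yaoEdge_of_crossing hδ hN hq h hcross⟩
    · exact ⟨j + 1, hjk, le_height_of_yaoEdge_of_crossing hδ hN hq h (by rwa [mul_comm])⟩
  have hclimb := (neg_le_abs _).trans (abs_coord_sub_le_dist (p 0) (p m) 1)
  have hlen := dist_le_sum_dist_of_le p hmk
  rw [hp0] at hclimb
  rw [hp0] at hlen
  nlinarith
end
end
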